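/- arXiv:2405.06144 — 3 statements merged into one kernel-verified Lean document; each statement's English description precedes it below -/
import Mathlib

section
/- Let a₁, a₂ be real numbers such that R is completely-S and let χ₁ be a constant satisfying the oscillation bound for R (i.e., every solution (g,M) of the deterministic Skorokhod problem satisfies sup_{u₁,u₂∈[t₁,t₂]}(|g(u₂)−g(u₁)| + |M(u₂)−M(u₁)|) ≤ χ₁ sup_{u₁,u₂∈[t₁,t₂]}|f(u₂)−f(u₁)| for all 0 ≤ t₁ ≤ t₂ ≤ t₀). Let t₀, c₁ > 0, let f : [0,t₀] → ℝ² be continuous with f(0) = 0, and let (g₁, M₁) and (g₂, M₂) be two solutions of the deterministic Skorokhod problem on [0,t₀] driven by f with initial points g₁(0) ≠ 0 and g₂(0) ≠ 0, respectively. Define t* = inf{t ∈ [0,t₀] : g₂(t) = 0} (with t* = t₀ if g₂ never hits the origin). If |g₁(0) − g₂(0)| ≤ c₁/4 and sup_{s ≤ t* } |g₁(s) − g₂(s)| ≥ c₁, then t* ≥ inf{y ≥ 0 : Osc(f, t₀, y) ≥ c₁/(4χ₁)}, where Osc(f, t₀, y) = sup{ |f(s₂) − f(s₁)| : 0 ≤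 s₁ ≤ s₂ ≤ s₁ + y ≤ t₀ }. -/
open Set

noncomputable section

/-- The plane `ℝ²` with the Euclidean norm. -/
abbrev E2 : Type := EuclideanSpace ℝ (Fin 2)

/-- The closed first quadrant `D = {(x,y) : x ≥ 0, y ≥ 0}`. -/
def quadrant : Set E2 := {p | 0 ≤ p 0 ∧ 0 ≤ p 1}

/-- The lower boundary face `Γ_d = {(x,0) : x ≥ 0}`. -/
def gammaD : Set E2 := {p | 0 ≤ p 0 ∧ p 1 = 0}

/-- The left boundary face `Γ_u = {(0,y) : y ≥ 0}`. -/
def gammaU : Set E2 := {p | p 0 = 0 ∧ 0 ≤ p 1}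

/-- A solution `(g, M)` of the deterministic Skorokhod problem on `[0, t₀]` in the quadrant,
with reflection matrix `R` having rows `(1, −a₁)` and `(−a₂, 1)`, driving function `f` and
initial point `x₀`: `g : [0,t₀] → D` is continuous, `M = (M¹, M²)` is continuous with
nondecreasing components and `M(0) = 0`, `M¹` (resp. `M²`) is constant on every subinterval
on which `g` does not meet `Γ_d` (resp. `Γ_u`), and `g(t) = x₀ + f(t) + R·M(t)`. -/
structure IsSkorokhodSolution (a₁ a₂ t₀ : ℝ) (x₀ : E2) (f g M : ℝ → E2) : Prop where
  g_cont : ContinuousOn g (Icc 0 t₀)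
  g_mem : ∀ t ∈ Icc (0 : ℝ) t₀, g t ∈ quadrant
  M_cont : ContinuousOn M (Icc 0 t₀)
  M_zero : M 0 = 0
  M_mono : ∀ i : Fin 2, ∀ s ∈ Icc (0 : ℝ) t₀, ∀ t ∈ Icc (0 : ℝ) t₀, s ≤ t → M s i ≤ M t i
  M1_flat : ∀ s ∈ Icc (0 : ℝ) t₀, ∀ t ∈ Icc (0 : ℝ) t₀, s ≤ t →
    (∀ r ∈ Icc s t, g r ∉ gammaD) → M s 0 = M t 0
  M2_flat : ∀ s ∈ Icc (0 : ℝ) t₀, ∀ t ∈ Icc (0 : ℝ) t₀, s ≤ t →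
    (∀ r ∈ Icc s t, g r ∉ gammaU) → M s 1 = M t 1
  eqn1 : ∀ t ∈ Icc (0 : ℝ) t₀, g t 0 = x₀ 0 + f t 0 + (M t 0 - a₁ * M t 1)
  eqn2 : ∀ t ∈ Icc (0 : ℝ) t₀, g t 1 = x₀ 1 + f t 1 + (-a₂ * M t 0 + M t 1)

/-- The matrix `R` with rows `(1, −a₁)` and `(−a₂, 1)` is completely-S. -/
def CompletelyS (a₁ a₂ : ℝ) : Prop :=
  ∃ z₁ z₂ : ℝ, 0 < z₁ ∧ 0 < z₂ ∧ 0 < z₁ - a₁ * z₂ ∧ 0 < -a₂ * z₁ + z₂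

/-- `Osc(f, t₀, y) = sup { |f(s₂) − f(s₁)| : 0 ≤ s₁ ≤ s₂ ≤ s₁ + y ≤ t₀ }`. -/
def Osc (f : ℝ → E2) (t₀ y : ℝ) : ℝ :=
  sSup {d : ℝ | ∃ s₁ s₂ : ℝ, 0 ≤ s₁ ∧ s₁ ≤ s₂ ∧ s₂ ≤ s₁ + y ∧ s₁ + y ≤ t₀ ∧
    d = ‖f s₂ - f s₁‖}

/-- A continuous function on `[0, T]` has bounded increments there. -/
theorem exists_norm_sub_le_of_continuousOn {T : ℝ} {h : ℝ → E2}
    (hh : ContinuousOn h (Icc 0 T)) :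
    ∃ C, ∀ s ∈ Icc 0 T, ∀ t ∈ Icc 0 T, ‖h t - h s‖ ≤ C := by
  obtain ⟨C, hC⟩ := isCompact_Icc.exists_bound_of_continuousOn hh
  exact ⟨C + C, fun s hs t ht => (norm_sub_le _ _).trans (add_le_add (hC t ht) (hC s hs))⟩

/-- An increment of `f` over an interval of length `s₂ - s₁` is bounded by the oscillation. -/
theorem norm_sub_le_Osc {f : ℝ → E2} {t₀ s₁ s₂ : ℝ} (hf : ContinuousOn f (Icc 0 t₀))
    (h₀ : 0 ≤ s₁) (h₁₂ : s₁ ≤ s₂) (h₂ : s₂ ≤ t₀) :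
    ‖f s₂ - f s₁‖ ≤ Osc f t₀ (s₂ - s₁) := by
  obtain ⟨C, hC⟩ := exists_norm_sub_le_of_continuousOn hf
  refine le_csSup ⟨C, ?_⟩ ⟨s₁, s₂, h₀, h₁₂, by linarith, by linarith, rfl⟩
  rintro d ⟨r₁, r₂, hr₀, hr₁₂, hr₂, hr, rfl⟩
  exact hC r₁ ⟨hr₀, by linarith⟩ r₂ ⟨by linarith, by linarith⟩

/-- Under the oscillation bound, a bound on the increments of `f` over `[0, T]` bounds the
displacement of `g` from its initial point. -/
theorem IsSkorokhodSolution.norm_sub_zero_le {a₁ a₂ t₀ χ T B : ℝ} {x₀ : E2} {f g M : ℝ → E2}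
    (h : IsSkorokhodSolution a₁ a₂ t₀ x₀ f g M) (hχ : 0 ≤ χ) (hT : T ≤ t₀)
    (hosc : (⨆ p : Icc 0 T × Icc 0 T, (‖g p.2.1 - g p.1.1‖ + ‖M p.2.1 - M p.1.1‖))
      ≤ χ * ⨆ p : Icc 0 T × Icc 0 T, ‖f p.2.1 - f p.1.1‖)
    (hB : ∀ s ∈ Icc 0 T, ∀ t ∈ Icc 0 T, ‖f t - f s‖ ≤ B) {s : ℝ} (hs : s ∈ Icc 0 T) :
    ‖g s - g 0‖ ≤ χ * B := by
  have h0 : (0 : ℝ) ∈ Icc 0 T := ⟨le_rfl, hs.1.trans hs.2⟩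
  have : Nonempty (Icc (0 : ℝ) T × Icc (0 : ℝ) T) := ⟨(⟨0, h0⟩, ⟨0, h0⟩)⟩
  have hsub : Icc 0 T ⊆ Icc 0 t₀ := Icc_subset_Icc_right hT
  obtain ⟨C, hC⟩ := exists_norm_sub_le_of_continuousOn (h.g_cont.mono hsub)
  obtain ⟨K, hK⟩ := exists_norm_sub_le_of_continuousOn (h.M_cont.mono hsub)
  have hbdd : BddAbove (range fun p : Icc (0 : ℝ) T × Icc (0 : ℝ) T =>
      ‖g p.2.1 - g p.1.1‖ + ‖M p.2.1 - M p.1.1‖) := by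
    refine ⟨C + K, ?_⟩
    rintro _ ⟨p, rfl⟩
    exact add_le_add (hC _ p.1.2 _ p.2.2) (hK _ p.1.2 _ p.2.2)
  calc ‖g s - g 0‖ ≤ ‖g s - g 0‖ + ‖M s - M 0‖ := le_add_of_nonneg_right (norm_nonneg _)
    _ ≤ _ := le_ciSup hbdd (⟨0, h0⟩, ⟨s, hs⟩)
    _ ≤ _ := hosc
    _ ≤ χ * B := mul_le_mul_of_nonneg_left
      (ciSup_le fun p => hB _ p.1.2 _ p.2.2) hχ

/-- If two solutions of the deterministic Skorokhod problem driven by the same `f` start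
within `c₁/4` of each other (away from the origin) and separate to distance at least `c₁`
before `g₂` hits the origin, then the hitting time `t*` of the origin by `g₂` is at least
the first `y` at which the oscillation `Osc(f, t₀, y)` reaches `c₁/(4χ₁)`. -/
theorem skorokhod_separation_time_bound (a₁ a₂ : ℝ) (hS : CompletelyS a₁ a₂)
    (χ₁ : ℝ) (hχpos : 0 < χ₁)
    (hχ : ∀ t₀ : ℝ, 0 < t₀ → ∀ x₀ ∈ quadrant, ∀ f g M : ℝ → E2,
        ContinuousOn f (Icc 0 t₀) → f 0 = 0 →
        IsSkorokhodSolution a₁ a₂ t₀ x₀ f g M →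
        ∀ t₁ t₂ : ℝ, 0 ≤ t₁ → t₁ ≤ t₂ → t₂ ≤ t₀ →
          (⨆ p : Icc t₁ t₂ × Icc t₁ t₂, (‖g p.2.1 - g p.1.1‖ + ‖M p.2.1 - M p.1.1‖))
            ≤ χ₁ * ⨆ p : Icc t₁ t₂ × Icc t₁ t₂, ‖f p.2.1 - f p.1.1‖)
    (t₀ c₁ : ℝ) (ht : 0 < t₀) (hc₁ : 0 < c₁)
    (f g₁ M₁ g₂ M₂ : ℝ → E2)
    (hf : ContinuousOn f (Icc 0 t₀)) (hf0 : f 0 = 0)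
    (h₁ : IsSkorokhodSolution a₁ a₂ t₀ (g₁ 0) f g₁ M₁)
    (h₂ : IsSkorokhodSolution a₁ a₂ t₀ (g₂ 0) f g₂ M₂)
    (h₁0 : g₁ 0 ≠ 0) (h₂0 : g₂ 0 ≠ 0)
    (tstar : ℝ) (htstar : tstar = sInf ({t | t ∈ Icc (0 : ℝ) t₀ ∧ g₂ t = 0} ∪ {t₀}))
    (hclose : ‖g₁ 0 - g₂ 0‖ ≤ c₁ / 4)
    (hsep : c₁ ≤ ⨆ s : Icc (0 : ℝ) tstar, ‖g₁ s.1 - g₂ s.1‖) :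
    sInf {y : ℝ | 0 ≤ y ∧ c₁ / (4 * χ₁) ≤ Osc f t₀ y} ≤ tstar := by
  have htle : tstar ≤ t₀ := by
    rw [htstar]
    refine csInf_le ⟨0, ?_⟩ (Or.inr rfl)
    rintro t (h | rfl)
    exacts [h.1.1, ht.le]
  have ht0 : 0 ≤ tstar := by
    rw [htstar]
    refine le_csInf ⟨t₀, Or.inr rfl⟩ ?_
    rintro t (h | rfl)
    exacts [h.1.1, ht.le]
  by_contra! hlt
  have hsmall : ∀ s t : ℝ, 0 ≤ s → s ≤ t → t ≤ tstar → ‖f t - f s‖ ≤ c₁ / (4 * χ₁) := by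
    intro s t hs hst htt
    by_contra! hbig
    have hle : sInf {y : ℝ | 0 ≤ y ∧ c₁ / (4 * χ₁) ≤ Osc f t₀ y} ≤ t - s :=
      csInf_le ⟨0, fun y hy => hy.1⟩
        ⟨sub_nonneg.2 hst, hbig.le.trans (norm_sub_le_Osc hf hs hst (htt.trans htle))⟩
    linarith
  have hB : ∀ s ∈ Icc 0 tstar, ∀ t ∈ Icc 0 tstar, ‖f t - f s‖ ≤ c₁ / (4 * χ₁) := by
    intro s hs t ht
    rcases le_total s t with hst | hst
    · exact hsmall s t hs.1 hst ht.2
    · rw [norm_sub_rev]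
      exact hsmall t s ht.1 hst hs.2
  have hχB : χ₁ * (c₁ / (4 * χ₁)) = c₁ / 4 := by field_simp
  have h0 : (0 : ℝ) ∈ Icc 0 t₀ := ⟨le_rfl, ht.le⟩
  have : Nonempty (Icc (0 : ℝ) tstar) := ⟨⟨0, le_rfl, ht0⟩⟩
  have hsup : (⨆ s : Icc (0 : ℝ) tstar, ‖g₁ s.1 - g₂ s.1‖) ≤ 3 * (c₁ / 4) := by
    refine ciSup_le fun ⟨s, hs⟩ => ?_
    have e₁ := h₁.norm_sub_zero_le hχpos.le htle
      (hχ t₀ ht _ (h₁.g_mem 0 h0) f g₁ M₁ hf hf0 h₁ 0 tstar le_rfl ht0 htle) hB hs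
    have e₂ := h₂.norm_sub_zero_le hχpos.le htle
      (hχ t₀ ht _ (h₂.g_mem 0 h0) f g₂ M₂ hf hf0 h₂ 0 tstar le_rfl ht0 htle) hB hs
    rw [hχB] at e₁ e₂
    calc ‖g₁ s - g₂ s‖ = ‖(g₁ s - g₁ 0) + (g₁ 0 - g₂ 0) - (g₂ s - g₂ 0)‖ := by
          congr 1; abel
      _ ≤ ‖g₁ s - g₁ 0‖ + ‖g₁ 0 - g₂ 0‖ + ‖g₂ s - g₂ 0‖ :=
          (norm_sub_le _ _).trans (add_le_add_left (norm_add_le _ _) _)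
      _ ≤ 3 * (c₁ / 4) := by linarith
  linarith
end
end

section
/- For all real numbers a₁ and a₂, there exist z₁, z₂ > 0 with z₁ − a₁z₂ > 0 and −a₂z₁ + z₂ > 0 if and only if a₁ ≤ 0, or a₂ ≤ 0, or a₁a₂ < 1. In particular, the matrix R with rows (1, −a₁) and (−a₂, 1) is completely-S whenever at least one of a₁, a₂ is negative, and for a₁, a₂ > 0 it is completely-S if and only if a₁a₂ < 1. -/
theorem completelyS_comm {a₁ a₂ : ℝ} : CompletelyS a₁ a₂ ↔ CompletelyS a₂ a₁ := by
  constructor <;> rintro ⟨z₁, z₂, h₁, h₂, h₃, h₄⟩ <;>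
    exact ⟨z₂, z₁, h₂, h₁, by linarith, by linarith⟩

theorem completelyS_of_nonpos_left {a₁ : ℝ} (a₂ : ℝ) (h : a₁ ≤ 0) : CompletelyS a₁ a₂ := by
  have hz : 0 < |a₂| + 1 := by positivity
  refine ⟨1, |a₂| + 1, one_pos, hz, ?_, ?_⟩
  · linarith [mul_nonpos_of_nonpos_of_nonneg h hz.le]
  · linarith [le_abs_self a₂]

theorem completelyS_of_nonpos_right (a₁ : ℝ) {a₂ : ℝ} (h : a₂ ≤ 0) : CompletelyS a₁ a₂ :=
  completelyS_comm.1 (completelyS_of_nonpos_left a₁ h)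

theorem completelyS_iff_of_pos {a₁ a₂ : ℝ} (h₁ : 0 < a₁) (h₂ : 0 < a₂) :
    CompletelyS a₁ a₂ ↔ a₁ * a₂ < 1 := by
  constructor
  · rintro ⟨z₁, z₂, hz₁, -, h₃, h₄⟩
    have h₅ : a₁ * (a₂ * z₁) < a₁ * z₂ := mul_lt_mul_of_pos_left (by linarith) h₁
    exact lt_of_mul_lt_mul_right (by linarith : a₁ * a₂ * z₁ < 1 * z₁) hz₁.le
  · intro h
    exact ⟨1 + a₁, 1 + a₂, by positivity, by positivity, by linarith, by linarith⟩

/-- `R` is completely-S iff `a₁ ≤ 0` or `a₂ ≤ 0` or `a₁a₂ < 1`.  In particular `R` is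
completely-S whenever one of `a₁, a₂` is negative, and for `a₁, a₂ > 0` it is completely-S
iff `a₁a₂ < 1`. -/
theorem completelyS_iff (a₁ a₂ : ℝ) :
    (CompletelyS a₁ a₂ ↔ a₁ ≤ 0 ∨ a₂ ≤ 0 ∨ a₁ * a₂ < 1) ∧
    ((a₁ < 0 ∨ a₂ < 0) → CompletelyS a₁ a₂) ∧
    (0 < a₁ → 0 < a₂ → (CompletelyS a₁ a₂ ↔ a₁ * a₂ < 1)) := by
  refine ⟨⟨fun h => ?_, ?_⟩, ?_, completelyS_iff_of_pos⟩
  · rcases le_or_gt a₁ 0 with h₁ | h₁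
    · exact .inl h₁
    rcases le_or_gt a₂ 0 with h₂ | h₂
    · exact .inr (.inl h₂)
    exact .inr (.inr ((completelyS_iff_of_pos h₁ h₂).1 h))
  · rintro (h | h | h)
    · exact completelyS_of_nonpos_left a₂ h
    · exact completelyS_of_nonpos_right a₁ h
    rcases le_or_gt a₁ 0 with h₁ | h₁
    · exact completelyS_of_nonpos_left a₂ h₁
    rcases le_or_gt a₂ 0 with h₂ | h₂
    · exact completelyS_of_nonpos_right a₁ h₂
    exact (completelyS_iff_of_pos h₁ h₂).2 h
  · rintro (h | h)
    · exact completelyS_of_nonpos_left a₂ h.le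
    · exact completelyS_of_nonpos_right a₁ h.le
end

section
/- Let θ₁ ∈ (0, π/2), θ₂ ∈ (−π/2, 0) with θ₁ + θ₂ > 0, set α = (θ₁+θ₂)/(π/2), and define h(z) = Im(e^{i(π/2−θ₁)} z^α) on the closed first quadrant D, regarded as a function of (x,y) ∈ ℝ². Then the directional derivative of h vanishes along the reflection vectors on the boundary away from the origin: for every x > 0, the derivative of h at the point (x, 0) in the direction (−tan θ₁, 1) equals 0, and for every y > 0, the derivative of h at the point (0, y) in the direction (1, −tan θ₂) equals 0. -/
open Complex
open scoped Real

/-- The real derivative of `Im (e^{iβ} z^α)` off the branch cut, in polar form. -/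
theorem fderiv_im_exp_mul_cpow (β α : ℝ) {z : ℂ} (hz : z ∈ slitPlane) (v : ℂ) :
    fderiv ℝ (fun w : ℂ => (exp (I * (β : ℂ)) * w ^ (α : ℂ)).im) z v =
      α * ‖z‖ ^ (α - 1) *
        (Real.cos (β + z.arg * (α - 1)) * v.im + Real.sin (β + z.arg * (α - 1)) * v.re) := by
  have hd : HasDerivAt (fun w : ℂ => exp (I * (β : ℂ)) * w ^ (α : ℂ))
      (exp (I * (β : ℂ)) * ((α : ℂ) * z ^ ((α : ℂ) - 1) * 1)) z :=
    ((hasDerivAt_id z).cpow_const hz).const_mul _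
  have hf := imCLM.hasFDerivAt.comp z (hd.hasFDerivAt.restrictScalars ℝ)
  have hpow : z ^ ((α : ℂ) - 1) = ((‖z‖ ^ (α - 1) : ℝ) : ℂ) *
      ((Real.cos (z.arg * (α - 1)) : ℂ) + (Real.sin (z.arg * (α - 1)) : ℂ) * I) := by
    rw [← cpow_ofReal]
    push_cast
    rfl
  have hexp : exp (I * (β : ℂ)) = (Real.cos β : ℂ) + (Real.sin β : ℂ) * I := by
    rw [mul_comm, exp_mul_I, ofReal_cos, ofReal_sin]
  have hval : fderiv ℝ (fun w : ℂ => (exp (I * (β : ℂ)) * w ^ (α : ℂ)).im) z v =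
      (v * (exp (I * (β : ℂ)) * ((α : ℂ) * z ^ ((α : ℂ) - 1) * 1))).im :=
    congrArg (fun L : ℂ →L[ℝ] ℝ => L v) hf.fderiv
  rw [hval, hpow, hexp, Real.cos_add, Real.sin_add]
  simp only [mul_im, mul_re, add_im, add_re, ofReal_re, ofReal_im, I_re, I_im, one_re, one_im]
  ring

/-- The directional derivative of `h(z) = Im(e^{i(π/2−θ₁)} z^α)` vanishes along the
reflection vectors on the boundary of the quadrant away from the origin: in the direction
`(−tan θ₁, 1)` at points `(x, 0)` with `x > 0`, and in the direction `(1, −tan θ₂)` at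
points `(0, y)` with `y > 0`. -/
theorem h_directional_derivative_vanishes (θ₁ θ₂ α : ℝ)
    (h₁ : θ₁ ∈ Set.Ioo 0 (π / 2)) (h₂ : θ₂ ∈ Set.Ioo (-(π / 2)) 0)
    (hsum : 0 < θ₁ + θ₂) (hα : α = (θ₁ + θ₂) / (π / 2))
    (h : ℂ → ℝ)
    (hh : ∀ z : ℂ, h z = (Complex.exp (Complex.I * ((π / 2 - θ₁ : ℝ) : ℂ)) *
      z ^ ((α : ℝ) : ℂ)).im) :
    (∀ x : ℝ, 0 < x →
      fderiv ℝ h (x : ℂ) (((-Real.tan θ₁ : ℝ) : ℂ) + Complex.I) = 0) ∧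
    (∀ y : ℝ, 0 < y →
      fderiv ℝ h ((y : ℂ) * Complex.I) (1 - ((Real.tan θ₂ : ℝ) : ℂ) * Complex.I) = 0) := by
  obtain rfl : h = _ := funext hh
  refine ⟨fun x hx => ?_, fun y hy => ?_⟩
  · have hcos : Real.cos θ₁ ≠ 0 :=
      (Real.cos_pos_of_mem_Ioo ⟨by linarith [h₁.1, h₁.2], h₁.2⟩).ne'
    rw [fderiv_im_exp_mul_cpow _ _ (ofReal_mem_slitPlane.2 hx), arg_ofReal_of_nonneg hx.le,
      zero_mul, add_zero, Real.cos_pi_div_two_sub, Real.sin_pi_div_two_sub]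
    simp only [add_im, add_re, ofReal_re, ofReal_im, I_re, I_im]
    linear_combination (-α * ‖(x : ℂ)‖ ^ (α - 1)) * Real.tan_mul_cos hcos
  · have hcos : Real.cos θ₂ ≠ 0 :=
      (Real.cos_pos_of_mem_Ioo ⟨h₂.1, by linarith [h₂.1, h₂.2]⟩).ne'
    have harg : ((y : ℂ) * I).arg = π / 2 := by rw [arg_real_mul I hy, arg_I]
    have hangle : π / 2 - θ₁ + π / 2 * (α - 1) = θ₂ := by
      rw [hα]
      field_simp
      ring
    have hz : (y : ℂ) * I ∈ slitPlane := Or.inr (by simpa using hy.ne')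
    rw [fderiv_im_exp_mul_cpow _ _ hz, harg, hangle]
    simp only [sub_im, sub_re, mul_im, mul_re, ofReal_re, ofReal_im, I_re, I_im,
      one_re, one_im]
    linear_combination (-α * ‖(y : ℂ) * I‖ ^ (α - 1)) * Real.tan_mul_cos hcos
end
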